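/- arXiv:2512.13672 — 8 statements merged into one kernel-verified Lean document; each statement's English description precedes it below -/
import Mathlib

section
/- Let d ≥ 1 and work in E = EuclideanSpace ℝ (Fin d). Define RMSNorm by RMSN(x) = √d • (x / ‖x‖). Fix v ∈ E with ‖v‖ = 1 and p ∈ E. Then, as m → ∞ along the real numbers, the function m ↦ RMSN(m • v + p) − RMSN(v) is O(1/m); that is, there exist a constant K ≥ 0 and m₀ such that for all m ≥ m₀, ‖RMSN(m • v + p) − RMSN(m • v)‖ ≤ K/m. (Note RMSN(m • v) = RMSN(v) for m > 0 by scale invariance.) -/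
noncomputable def RMSN {d : ℕ} (x : EuclideanSpace ℝ (Fin d)) : EuclideanSpace ℝ (Fin d) :=
  (Real.sqrt d) • (‖x‖⁻¹ • x)

theorem norm_normalize_sub_normalize_le {V : Type*} [NormedAddCommGroup V] [NormedSpace ℝ V]
    (x : V) {y : V} (hy : y ≠ 0) :
    ‖‖x‖⁻¹ • x - ‖y‖⁻¹ • y‖ ≤ 2 * ‖x - y‖ / ‖y‖ := by
  have hy' : 0 < ‖y‖ := norm_pos_iff.mpr hy
  have radial : ‖(‖x‖⁻¹ - ‖y‖⁻¹) • x‖ ≤ ‖x - y‖ / ‖y‖ := by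
    rcases eq_or_ne x 0 with rfl | hx
    · rw [smul_zero, norm_zero]
      positivity
    have hx' : 0 < ‖x‖ := norm_pos_iff.mpr hx
    rw [norm_smul, Real.norm_eq_abs, inv_sub_inv hx'.ne' hy'.ne', abs_div,
      abs_of_pos (mul_pos hx' hy'), div_mul_eq_mul_div, mul_comm ‖x‖ ‖y‖,
      mul_div_mul_right _ _ hx'.ne', abs_sub_comm]
    gcongr
    exact abs_norm_sub_norm_le x y
  have tangential : ‖‖y‖⁻¹ • (x - y)‖ = ‖x - y‖ / ‖y‖ := by
    rw [norm_smul, norm_inv, norm_norm, inv_mul_eq_div]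
  calc ‖‖x‖⁻¹ • x - ‖y‖⁻¹ • y‖
      = ‖(‖x‖⁻¹ - ‖y‖⁻¹) • x + ‖y‖⁻¹ • (x - y)‖ := by
        congr 1
        module
    _ ≤ ‖(‖x‖⁻¹ - ‖y‖⁻¹) • x‖ + ‖‖y‖⁻¹ • (x - y)‖ := norm_add_le _ _
    _ ≤ ‖x - y‖ / ‖y‖ + ‖x - y‖ / ‖y‖ := add_le_add radial tangential.le
    _ = 2 * ‖x - y‖ / ‖y‖ := by ring

/-- Lemma 1 (RMSNorm case), asymptotic form: the positional contribution to the
RMS-normalized signal is `O(1/m)` as `m → ∞`. -/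
theorem rmsnorm_positional_attenuation_bigO
    (d : ℕ) (hd : 1 ≤ d) (v p : EuclideanSpace ℝ (Fin d)) (hv : ‖v‖ = 1) :
    ∃ K : ℝ, 0 ≤ K ∧ ∃ m₀ : ℝ, ∀ m : ℝ, m₀ ≤ m →
      ‖RMSN (m • v + p) - RMSN (m • v)‖ ≤ K / m := by
  refine ⟨√d * (2 * ‖p‖), by positivity, 1, fun m hm => ?_⟩
  have hm' : 0 < m := one_pos.trans_le hm
  have hv' : v ≠ 0 := norm_pos_iff.mp (hv ▸ one_pos)
  have key := norm_normalize_sub_normalize_le (m • v + p) (smul_ne_zero hm'.ne' hv')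
  have hnorm : ‖m • v‖ = m := by
    rw [norm_smul, hv, mul_one, Real.norm_of_nonneg hm'.le]
  rw [add_sub_cancel_left, hnorm] at key
  rw [RMSN, RMSN, ← smul_sub, norm_smul, Real.norm_of_nonneg (Real.sqrt_nonneg _),
    mul_div_assoc, hnorm]
  gcongr
end

section
/- Let d ≥ 1 and work in E = EuclideanSpace ℝ (Fin d). Define RMSNorm by RMSN(x) = √d • (x / ‖x‖). Fix v ∈ E with ‖v‖ = 1 and p ∈ E. Then for every real m > ‖p‖, ‖RMSN(m • v + p) − RMSN(m • v)‖ ≤ 2 √d ‖p‖ / m. -/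
/-- Normalization of vectors is Lipschitz away from the origin. -/
theorem norm_inv_norm_smul_sub_le {E : Type*} [NormedAddCommGroup E] [NormedSpace ℝ E]
    (x : E) {y : E} (hy : y ≠ 0) :
    ‖‖x‖⁻¹ • x - ‖y‖⁻¹ • y‖ ≤ 2 * ‖x - y‖ / ‖y‖ := by
  have hy' : ‖y‖ ≠ 0 := norm_ne_zero_iff.mpr hy
  have key : ‖x‖⁻¹ • x - ‖y‖⁻¹ • y =
      ‖y‖⁻¹ • ((x - y) + (‖y‖ - ‖x‖) • (‖x‖⁻¹ • x)) := by
    rcases eq_or_ne x 0 with rfl | hx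
    · simp
    · have hx' : ‖x‖ ≠ 0 := norm_ne_zero_iff.mpr hx
      match_scalars
      · field_simp
        ring
      · ring
  have hunit : ‖‖x‖⁻¹ • x‖ ≤ 1 := by
    rw [norm_smul, norm_inv, norm_norm]
    exact inv_mul_le_one
  have hscale : ‖(‖y‖ - ‖x‖) • (‖x‖⁻¹ • x)‖ ≤ ‖x - y‖ := by
    rw [norm_smul, Real.norm_eq_abs, abs_sub_comm]
    exact (mul_le_of_le_one_right (abs_nonneg _) hunit).trans (abs_norm_sub_norm_le x y)
  rw [key, norm_smul, norm_inv, norm_norm, div_eq_inv_mul]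
  gcongr
  linarith [norm_add_le (x - y) ((‖y‖ - ‖x‖) • (‖x‖⁻¹ • x))]

/-- Lemma 1 (RMSNorm case), explicit non-asymptotic form. -/
theorem rmsnorm_positional_attenuation_explicit
    (d : ℕ) (hd : 1 ≤ d) (v p : EuclideanSpace ℝ (Fin d)) (hv : ‖v‖ = 1) :
    ∀ m : ℝ, ‖p‖ < m →
      ‖RMSN (m • v + p) - RMSN (m • v)‖ ≤ 2 * Real.sqrt d * ‖p‖ / m := by
  intro m hm
  have hm0 : 0 < m := (norm_nonneg p).trans_lt hm
  have hnorm : ‖m • v‖ = m := by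
    rw [norm_smul, hv, mul_one, Real.norm_of_nonneg hm0.le]
  have hne : m • v ≠ 0 := norm_ne_zero_iff.mp (hnorm.symm ▸ hm0.ne')
  have h := norm_inv_norm_smul_sub_le (m • v + p) hne
  rw [add_sub_cancel_left] at h
  rw [RMSN, RMSN, ← smul_sub, norm_smul, Real.norm_of_nonneg (Real.sqrt_nonneg _)]
  calc
    _ ≤ Real.sqrt d * (2 * ‖p‖ / ‖m • v‖) := by gcongr
    _ = 2 * Real.sqrt d * ‖p‖ / m := by rw [hnorm]; ring
end

section
/- Let d ≥ 1 and work in E = EuclideanSpace ℝ (Fin d). Define RMSNorm by RMSN(x) = √d • (x / ‖x‖). Fix v ∈ E with ‖v‖ = 1 and p ∈ E. Then lim_{m → ∞} m • (RMSN(m • v + p) − RMSN(v)) = √d • (p − ⟪v, p⟫ • v), i.e., the first-order positional contribution after RMSNorm is exactly √d times the component of p orthogonal to v, scaled by 1/m. -/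
open scoped RealInnerProductSpace

theorem RMSN_smul_of_pos {d : ℕ} {c : ℝ} (hc : 0 < c) (x : EuclideanSpace ℝ (Fin d)) :
    RMSN (c • x) = RMSN x := by
  simp only [RMSN, norm_smul, Real.norm_of_nonneg hc.le, smul_smul]
  congr 2
  field_simp

/-- The derivative of `x ↦ ‖x‖⁻¹ • x` at a unit vector is the projection orthogonal to it. -/
theorem HasDerivAt.norm_inv_smul_self {F : Type*} [NormedAddCommGroup F] [InnerProductSpace ℝ F]
    {f : ℝ → F} {f' : F} {t : ℝ} (hf : HasDerivAt f f' t) (ht : ‖f t‖ = 1) :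
    HasDerivAt (fun s => ‖f s‖⁻¹ • f s) (f' - ⟪f t, f'⟫ • f t) t := by
  have hnorm : HasDerivAt (fun s => ‖f s‖) ⟪f t, f'⟫ t := by
    simpa [ht] using hf.norm_sq.sqrt (by simp [ht])
  have hinv : HasDerivAt (fun s => ‖f s‖⁻¹) (-⟪f t, f'⟫) t := by
    simpa [ht] using hnorm.fun_inv (by simp [ht])
  convert hinv.fun_smul hf using 1
  simp [ht, sub_eq_add_neg]

/-- Lemma 1 (RMSNorm case), sharp first-order version: the rescaled positional
contribution converges to `√d` times the component of `p` orthogonal to `v`. -/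
theorem rmsnorm_positional_attenuation_firstOrder
    (d : ℕ) (hd : 1 ≤ d) (v p : EuclideanSpace ℝ (Fin d)) (hv : ‖v‖ = 1) :
    Filter.Tendsto (fun m : ℝ => m • (RMSN (m • v + p) - RMSN v))
      Filter.atTop (nhds ((Real.sqrt d) • (p - ⟪v, p⟫ • v))) := by
  have hline : HasDerivAt (fun t : ℝ => v + t • p) p 0 := by
    simpa using ((hasDerivAt_id (0 : ℝ)).smul_const p).const_add v
  have hderiv : HasDerivAt (fun t : ℝ => RMSN (v + t • p))
      ((Real.sqrt d) • (p - ⟪v, p⟫ • v)) 0 := by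
    simpa [RMSN] using (hline.norm_inv_smul_self (by simpa using hv)).fun_const_smul (Real.sqrt d)
  refine (hderiv.tendsto_slope_zero_right.comp tendsto_inv_atTop_nhdsGT_zero).congr' ?_
  filter_upwards [Filter.eventually_gt_atTop 0] with m hm
  have hscale : RMSN (m • v + p) = RMSN (v + m⁻¹ • p) := by
    rw [← RMSN_smul_of_pos hm (v + m⁻¹ • p), smul_add, smul_inv_smul₀ hm.ne']
  simp [hscale]
end

section
/- Let E be a real inner product space, let x ∈ E be nonzero, and let δ ∈ E with ‖δ‖ < ‖x‖. Then x + δ ≠ 0 and the undirected angle between x and x + δ satisfies angle(x, x + δ) ≤ arcsin(‖δ‖ / ‖x‖). -/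
open InnerProductGeometry

/-- Geometric core of Lemma 2 (residual stagnation): a perturbation of norm
`‖δ‖ < ‖x‖` rotates the direction of `x` by at most `arcsin (‖δ‖/‖x‖)`. -/
theorem angle_perturbation
    {E : Type*} [NormedAddCommGroup E] [InnerProductSpace ℝ E]
    (x δ : E) (hx : x ≠ 0) (hδ : ‖δ‖ < ‖x‖) :
    x + δ ≠ 0 ∧ angle x (x + δ) ≤ Real.arcsin (‖δ‖ / ‖x‖) := by
  have hx_pos : 0 < ‖x‖ := norm_pos_iff.mpr hx
  have h_ne : x + δ ≠ 0 := fun h ↦ by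
    rw [eq_neg_of_add_eq_zero_left h, norm_neg] at hδ
    exact lt_irrefl _ hδ
  refine ⟨h_ne, ?_⟩
  have hy_pos : 0 < ‖x + δ‖ := norm_pos_iff.mpr h_ne
  rw [Real.arcsin_eq_arccos (by positivity), angle]
  apply Real.arccos_le_arccos
  rw [le_div_iff₀ (mul_pos hx_pos hy_pos)]
  have h_ratio : (‖δ‖ / ‖x‖) ^ 2 ≤ 1 :=
    pow_le_one₀ (by positivity) ((div_le_one hx_pos).mpr hδ.le)
  have h_sqrt : (‖x‖ * √(1 - (‖δ‖ / ‖x‖) ^ 2)) ^ 2 = ‖x‖ ^ 2 - ‖δ‖ ^ 2 := by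
    rw [mul_pow, Real.sq_sqrt (sub_nonneg.mpr h_ratio)]
    field_simp
  have h_law := norm_sub_sq_real (x + δ) x
  rw [add_sub_cancel_left, real_inner_comm] at h_law
  nlinarith [sq_nonneg (‖x‖ * √(1 - (‖δ‖ / ‖x‖) ^ 2) - ‖x + δ‖)]
end

section
/- Let d ≥ 1 and work in E = EuclideanSpace ℝ (Fin d). Define RMSNorm by RMSN(x) = √d • (x / ‖x‖). Let F : E → E, let x ∈ E with x ≠ 0, and suppose B ∈ ℝ satisfies ‖F(u)‖ ≤ B for all u ∈ E with ‖u‖ = √d. Set y = x + F(RMSN(x)). Then: (i) ‖y − x‖ ≤ B, so the relative change satisfies ‖y − x‖/‖x‖ ≤ B/‖x‖; and (ii) if moreover B < ‖x‖, then y ≠ 0 and angle(x, y) ≤ arcsin(B / ‖x‖). -/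
open InnerProductGeometry

theorem norm_RMSN {d : ℕ} {x : EuclideanSpace ℝ (Fin d)} (hx : x ≠ 0) :
    ‖RMSN x‖ = Real.sqrt d := by
  have hx' : ‖x‖ ≠ 0 := norm_ne_zero_iff.mpr hx
  rw [RMSN, norm_smul, norm_smul, norm_inv, norm_norm, inv_mul_cancel₀ hx', mul_one,
    Real.norm_of_nonneg (Real.sqrt_nonneg _)]

theorem angle_le_arcsin_of_norm_sub_lt {V : Type*} [NormedAddCommGroup V]
    [InnerProductSpace ℝ V] {x y : V} (h : ‖x - y‖ < ‖x‖) :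
    angle x y ≤ Real.arcsin (‖x - y‖ / ‖x‖) := by
  have hx : 0 < ‖x‖ := (norm_nonneg _).trans_lt h
  have hinner : 0 ≤ inner ℝ x y := by
    have h₁ := norm_sub_sq_real x y
    nlinarith [norm_nonneg (x - y), sq_nonneg ‖y‖]
  have hangle : angle x y ≤ Real.pi / 2 :=
    Real.arccos_le_pi_div_two.mpr (by positivity)
  rw [Real.le_arcsin_iff_sin_le' ⟨by linarith [angle_nonneg x y, Real.pi_pos], hangle⟩,
    le_div_iff₀ hx, sin_angle_mul_norm_eq_sin_angle_mul_norm]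
  exact mul_le_of_le_one_left (norm_nonneg _) (Real.sin_le_one _)

/-- Lemma 2 (residual stagnation in a pre-norm block): one pre-norm block
`y = x + F (RMSN x)` with sub-layer bounded by `B` on the sphere of radius `√d`
moves `x` by at most `B` and rotates its direction by at most `arcsin (B/‖x‖)`. -/
theorem prenorm_residual_stagnation
    (d : ℕ) (hd : 1 ≤ d) (F : EuclideanSpace ℝ (Fin d) → EuclideanSpace ℝ (Fin d))
    (x : EuclideanSpace ℝ (Fin d)) (hx : x ≠ 0) (B : ℝ)
    (hF : ∀ u : EuclideanSpace ℝ (Fin d), ‖u‖ = Real.sqrt d → ‖F u‖ ≤ B)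
    (y : EuclideanSpace ℝ (Fin d)) (hy : y = x + F (RMSN x)) :
    ‖y - x‖ ≤ B ∧ ‖y - x‖ / ‖x‖ ≤ B / ‖x‖ ∧
      (B < ‖x‖ → y ≠ 0 ∧ angle x y ≤ Real.arcsin (B / ‖x‖)) := by
  have hxy : ‖y - x‖ ≤ B := by
    rw [hy, add_sub_cancel_left]
    exact hF _ (norm_RMSN hx)
  refine ⟨hxy, by gcongr, fun hB => ?_⟩
  have hlt : ‖x - y‖ < ‖x‖ := by
    rw [norm_sub_rev]
    exact hxy.trans_lt hB
  constructor
  · rintro rfl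
    simp at hlt
  · refine (angle_le_arcsin_of_norm_sub_lt hlt).trans (Real.arcsin_le_arcsin ?_)
    rw [norm_sub_rev]
    gcongr
end

section
/- Let E be a real inner product space, L ∈ ℕ, B : ℕ → ℝ with B ℓ ≥ 0 for all ℓ, and set S_L = Σ_{ℓ < L} B ℓ. Let x : ℕ → E satisfy ‖x (ℓ+1) − x ℓ‖ ≤ B ℓ for all ℓ < L, and assume ‖x 0‖ > S_L. Then x 0 ≠ 0, x L ≠ 0, and angle(x 0, x L) ≤ (π/2) · Σ_{ℓ < L} B ℓ / (‖x 0‖ − Σ_{j < ℓ} B j) ≤ (π/2) · S_L / (‖x 0‖ − S_L). -/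
open InnerProductGeometry

theorem angle_le_pi_div_two_mul_norm_sub_div_norm
    {E : Type*} [NormedAddCommGroup E] [InnerProductSpace ℝ E] {x y : E}
    (h : ‖y - x‖ < ‖x‖) :
    angle x y ≤ (Real.pi / 2) * (‖y - x‖ / ‖x‖) := by
  have hx : 0 < ‖x‖ := (norm_nonneg _).trans_lt h
  have hacute : angle x y ≤ Real.pi / 2 := by
    rw [angle, Real.arccos_le_pi_div_two, real_inner_comm]
    refine div_nonneg ?_ (by positivity)
    nlinarith [norm_sub_sq_real y x, norm_nonneg (y - x), sq_nonneg ‖y‖]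
  have hsin : Real.sin (angle x y) * ‖x‖ ≤ ‖y - x‖ := by
    rw [sin_angle_mul_norm_eq_sin_angle_mul_norm, norm_sub_rev x y]
    exact mul_le_of_le_one_left (norm_nonneg _) (Real.sin_le_one _)
  calc
    angle x y = (Real.pi / 2) * (2 / Real.pi * angle x y) := by
      field_simp
    _ ≤ (Real.pi / 2) * (‖y - x‖ / ‖x‖) := by
      gcongr
      exact (Real.mul_le_sin (angle_nonneg x y) hacute).trans ((le_div_iff₀ hx).2 hsin)

theorem norm_sub_sum_le_norm_of_norm_sub_le
    {E : Type*} [SeminormedAddCommGroup E] {L : ℕ} {B : ℕ → ℝ} {x : ℕ → E}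
    (hx : ∀ ℓ < L, ‖x (ℓ + 1) - x ℓ‖ ≤ B ℓ) {n : ℕ} (hn : n ≤ L) :
    ‖x 0‖ - ∑ j ∈ Finset.range n, B j ≤ ‖x n‖ := by
  have h : ‖x n - x 0‖ ≤ ∑ j ∈ Finset.range n, B j := by
    rw [← Finset.sum_range_sub]
    exact norm_sum_le_of_le _ fun j hj ↦ hx j ((Finset.mem_range.1 hj).trans_le hn)
  linarith [norm_sub_norm_le (x 0) (x n), norm_sub_rev (x 0) (x n)]

/-- Proposition 1 (accumulated directional drift), abstract form: a sequence
whose per-step updates are bounded by `B ℓ` and whose initial norm exceeds the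
total budget `S_L = ∑_{ℓ<L} B ℓ` accumulates only a bounded directional drift. -/
theorem accumulated_directional_drift
    {E : Type*} [NormedAddCommGroup E] [InnerProductSpace ℝ E]
    (L : ℕ) (B : ℕ → ℝ) (hB : ∀ ℓ, 0 ≤ B ℓ) (x : ℕ → E)
    (hx : ∀ ℓ < L, ‖x (ℓ + 1) - x ℓ‖ ≤ B ℓ)
    (h0 : ∑ ℓ ∈ Finset.range L, B ℓ < ‖x 0‖) :
    x 0 ≠ 0 ∧ x L ≠ 0 ∧
      angle (x 0) (x L) ≤
        (Real.pi / 2) *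
          ∑ ℓ ∈ Finset.range L, B ℓ / (‖x 0‖ - ∑ j ∈ Finset.range ℓ, B j) ∧
      (Real.pi / 2) *
          ∑ ℓ ∈ Finset.range L, B ℓ / (‖x 0‖ - ∑ j ∈ Finset.range ℓ, B j) ≤
        (Real.pi / 2) * ((∑ ℓ ∈ Finset.range L, B ℓ) /
          (‖x 0‖ - ∑ ℓ ∈ Finset.range L, B ℓ)) := by
  have hsum {m n : ℕ} (hmn : m ≤ n) :
      ∑ j ∈ Finset.range m, B j ≤ ∑ j ∈ Finset.range n, B j :=
    Finset.sum_le_sum_of_subset_of_nonneg (Finset.range_mono hmn) fun j _ _ ↦ hB j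
  have hS : 0 ≤ ∑ ℓ ∈ Finset.range L, B ℓ := Finset.sum_nonneg fun j _ ↦ hB j
  have hdrift : ∀ n ≤ L, angle (x 0) (x n) ≤ (Real.pi / 2) *
      ∑ ℓ ∈ Finset.range n, B ℓ / (‖x 0‖ - ∑ j ∈ Finset.range ℓ, B j) := by
    intro n
    induction n with
    | zero =>
      intro _
      simp [angle_self (norm_pos_iff.1 (hS.trans_lt h0))]
    | succ n ih =>
      intro hn
      have hnorm := norm_sub_sum_le_norm_of_norm_sub_le hx (Nat.le_of_succ_le hn)
      have hstep := hx n hn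
      have hbudget := hsum hn
      rw [Finset.sum_range_succ] at hbudget
      have hpos : 0 < ‖x 0‖ - ∑ j ∈ Finset.range n, B j := by linarith [hB n]
      rw [Finset.sum_range_succ, mul_add]
      calc
        angle (x 0) (x (n + 1)) ≤ angle (x 0) (x n) + angle (x n) (x (n + 1)) :=
          angle_le_angle_add_angle _ _ _
        _ ≤ _ := by
          refine add_le_add (ih (Nat.le_of_succ_le hn))
            ((angle_le_pi_div_two_mul_norm_sub_div_norm (by linarith)).trans ?_)
          have := hB n
          gcongr
  refine ⟨norm_pos_iff.1 (hS.trans_lt h0), norm_pos_iff.1 ?_, hdrift L le_rfl, ?_⟩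
  · linarith [norm_sub_sum_le_norm_of_norm_sub_le hx le_rfl]
  · rw [Finset.sum_div]
    refine mul_le_mul_of_nonneg_left (Finset.sum_le_sum fun ℓ hℓ ↦ ?_) (by positivity)
    exact div_le_div_of_nonneg_left (hB ℓ) (sub_pos.2 h0)
      (sub_le_sub_left (hsum (Finset.mem_range.1 hℓ).le) _)
end

section
/- Let d ≥ 1 and work in E = EuclideanSpace ℝ (Fin d). Define RMSNorm by RMSN(x) = √d • (x / ‖x‖). Let L ∈ ℕ, let F : ℕ → (E → E), let B : ℕ → ℝ be such that for every ℓ < L and every u ∈ E with ‖u‖ = √d one has 0 ≤ B ℓ and ‖F ℓ u‖ ≤ B ℓ, and set S_L = Σ_{ℓ < L} B ℓ. Let x : ℕ → E satisfy the pre-norm recursion x (ℓ+1) = x ℓ + F ℓ (RMSN(x ℓ)) for all ℓ < L, and assume ‖x 0‖ > S_L. Then x ℓ ≠ 0 for all ℓ ≤ L and angle(x 0, x L) ≤ (π/2) · Σ_{ℓ < L} B ℓ / (‖x 0‖ − Σ_{j < ℓ} B j) ≤ (π/2) · S_L / (‖x 0‖ − S_L). -/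
open InnerProductGeometry

section InnerProductSpace

variable {V : Type*} [NormedAddCommGroup V] [InnerProductSpace ℝ V]

theorem norm_mul_sin_angle_le_norm_sub (x y : V) :
    ‖x‖ * Real.sin (angle x y) ≤ ‖y - x‖ := by
  refine le_of_sq_le_sq ?_ (norm_nonneg _)
  rw [norm_sub_sq_real, real_inner_comm, ← cos_angle_mul_norm_mul_norm x y]
  linear_combination sq_nonneg (‖y‖ - ‖x‖ * Real.cos (angle x y)) +
    ‖x‖ ^ 2 * Real.sin_sq_add_cos_sq (angle x y)

theorem angle_self_add_le_pi_div_two {x v : V} (hv : ‖v‖ ≤ ‖x‖) :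
    angle x (x + v) ≤ Real.pi / 2 := by
  refine Real.arccos_le_pi_div_two.mpr (div_nonneg ?_ (by positivity))
  rw [inner_add_right, real_inner_self_eq_norm_mul_norm]
  have h := neg_le_of_abs_le (abs_real_inner_le_norm x v)
  linarith [mul_le_mul_of_nonneg_left hv (norm_nonneg x)]

/-- A perturbation shorter than the vector rotates it by at most `π / 2` times the ratio of the
lengths. -/
theorem angle_self_add_le {x v : V} (hx : x ≠ 0) (hv : ‖v‖ ≤ ‖x‖) :
    angle x (x + v) ≤ Real.pi / 2 * (‖v‖ / ‖x‖) := by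
  have hsin := norm_mul_sin_angle_le_norm_sub x (x + v)
  rw [add_sub_cancel_left] at hsin
  have hx' : 0 < ‖x‖ := norm_pos_iff.mpr hx
  calc angle x (x + v) = Real.pi / 2 * (2 / Real.pi * angle x (x + v)) := by
        field_simp [Real.pi_ne_zero]
    _ ≤ Real.pi / 2 * Real.sin (angle x (x + v)) :=
        mul_le_mul_of_nonneg_left
          (Real.mul_le_sin (angle_nonneg _ _) (angle_self_add_le_pi_div_two hv))
          (by positivity)
    _ ≤ Real.pi / 2 * (‖v‖ / ‖x‖) := by
        gcongr
        rwa [le_div_iff₀ hx', mul_comm]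

end InnerProductSpace

/-- Proposition 1 (accumulated directional drift across `L` pre-norm blocks),
with RMSNorm made explicit. -/
theorem accumulated_directional_drift_prenorm
    (d : ℕ) (hd : 1 ≤ d) (L : ℕ)
    (F : ℕ → EuclideanSpace ℝ (Fin d) → EuclideanSpace ℝ (Fin d)) (B : ℕ → ℝ)
    (hF : ∀ ℓ < L, ∀ u : EuclideanSpace ℝ (Fin d), ‖u‖ = Real.sqrt d →
      0 ≤ B ℓ ∧ ‖F ℓ u‖ ≤ B ℓ)
    (x : ℕ → EuclideanSpace ℝ (Fin d))
    (hx : ∀ ℓ < L, x (ℓ + 1) = x ℓ + F ℓ (RMSN (x ℓ)))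
    (h0 : ∑ ℓ ∈ Finset.range L, B ℓ < ‖x 0‖) :
    (∀ ℓ ≤ L, x ℓ ≠ 0) ∧
      angle (x 0) (x L) ≤
        (Real.pi / 2) *
          ∑ ℓ ∈ Finset.range L, B ℓ / (‖x 0‖ - ∑ j ∈ Finset.range ℓ, B j) ∧
      (Real.pi / 2) *
          ∑ ℓ ∈ Finset.range L, B ℓ / (‖x 0‖ - ∑ j ∈ Finset.range ℓ, B j) ≤
        (Real.pi / 2) * ((∑ ℓ ∈ Finset.range L, B ℓ) /
          (‖x 0‖ - ∑ ℓ ∈ Finset.range L, B ℓ)) := by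
  have hB : ∀ ℓ < L, 0 ≤ B ℓ := fun ℓ hℓ =>
    (hF ℓ hℓ (EuclideanSpace.single ⟨0, hd⟩ (Real.sqrt d))
      (by simp [abs_of_nonneg (Real.sqrt_nonneg _)])).1
  have hsum : ∀ ℓ ≤ L, ∑ j ∈ Finset.range ℓ, B j ≤ ∑ j ∈ Finset.range L, B j := fun ℓ hℓ =>
    Finset.sum_le_sum_of_subset_of_nonneg (Finset.range_subset_range.mpr hℓ)
      fun j hj _ => hB j (Finset.mem_range.mp hj)
  have hne : ∀ ℓ ≤ L, ‖x 0‖ - ∑ j ∈ Finset.range ℓ, B j ≤ ‖x ℓ‖ → x ℓ ≠ 0 := fun ℓ hℓ h =>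
    norm_pos_iff.mp (by linarith [hsum ℓ hℓ])
  have hnorm : ∀ ℓ ≤ L, ‖x 0‖ - ∑ j ∈ Finset.range ℓ, B j ≤ ‖x ℓ‖ := by
    intro ℓ
    induction ℓ with
    | zero => simp
    | succ ℓ ih =>
      intro hℓ
      have h := ih (by omega)
      have hFB := (hF ℓ hℓ _ (norm_RMSN (hne ℓ (by omega) h))).2
      rw [hx ℓ hℓ, Finset.sum_range_succ]
      linarith [norm_sub_le_norm_add (x ℓ) (F ℓ (RMSN (x ℓ)))]
  have hx0 : ∀ ℓ ≤ L, x ℓ ≠ 0 := fun ℓ hℓ => hne ℓ hℓ (hnorm ℓ hℓ)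
  have hangle : ∀ ℓ ≤ L, angle (x 0) (x ℓ) ≤ (Real.pi / 2) *
      ∑ k ∈ Finset.range ℓ, B k / (‖x 0‖ - ∑ j ∈ Finset.range k, B j) := by
    intro ℓ
    induction ℓ with
    | zero => simp [angle_self (hx0 0 (Nat.zero_le L))]
    | succ ℓ ih =>
      intro hℓ
      have hFB := (hF ℓ hℓ _ (norm_RMSN (hx0 ℓ (by omega)))).2
      have hS := hsum (ℓ + 1) hℓ
      rw [Finset.sum_range_succ] at hS
      have hN := hnorm ℓ (by omega)
      have hpos : 0 < ‖x 0‖ - ∑ j ∈ Finset.range ℓ, B j := by linarith [hB ℓ hℓ]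
      have hstep : angle (x ℓ) (x (ℓ + 1)) ≤
          Real.pi / 2 * (B ℓ / (‖x 0‖ - ∑ j ∈ Finset.range ℓ, B j)) := by
        rw [hx ℓ hℓ]
        refine (angle_self_add_le (hx0 ℓ (by omega)) (by linarith)).trans ?_
        gcongr
        exact hB ℓ hℓ
      rw [Finset.sum_range_succ, mul_add]
      exact (angle_le_angle_add_angle _ (x ℓ) _).trans (add_le_add (ih (by omega)) hstep)
  refine ⟨hx0, hangle L le_rfl, mul_le_mul_of_nonneg_left ?_ (by positivity)⟩
  rw [Finset.sum_div]
  refine Finset.sum_le_sum fun ℓ hℓ => ?_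
  have hℓ := Finset.mem_range.mp hℓ
  exact div_le_div_of_nonneg_left (hB ℓ hℓ) (sub_pos.mpr h0)
    (sub_le_sub_left (hsum ℓ hℓ.le) _)
end

section
/- Let d ≥ 1 and work in E = EuclideanSpace ℝ (Fin d). Define RMSNorm by RMSN(x) = √d • (x / ‖x‖). Let L ∈ ℕ, let F : ℕ → (E → E), let B : ℕ → ℝ be such that for every ℓ < L and every u ∈ E with ‖u‖ = √d one has 0 ≤ B ℓ and ‖F ℓ u‖ ≤ B ℓ, and set S_L = Σ_{ℓ < L} B ℓ. Fix x₀ ∈ E with x₀ ≠ 0. For each real α, let x_α : ℕ → E be a sequence with x_α 0 = α • x₀ satisfying x_α (ℓ+1) = x_α ℓ + F ℓ (RMSN(x_α ℓ)) for all ℓ < L. Then: (i) for every α with α ‖x₀‖ > S_L, angle(α • x₀, x_α L) ≤ (π/2) · S_L / (α ‖x₀‖ − S_L); and (ii) the right-hand bound tends to 0 as α → ∞, so angle(α • x₀, x_α L) → 0 as α → ∞ (directional freezing). -/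
open InnerProductGeometry

/-- The angle between two vectors of norm at least `m` is at most `π / 2` times their distance
divided by `m`. -/
theorem angle_le_pi_div_two_mul_norm_sub_div {V : Type*} [NormedAddCommGroup V]
    [InnerProductSpace ℝ V] {a b : V} {m : ℝ} (hm : 0 < m) (ha : m ≤ ‖a‖) (hb : m ≤ ‖b‖) :
    angle a b ≤ Real.pi / 2 * (‖a - b‖ / m) := by
  have hcos : Real.cos (angle a b) ≤ 1 - 2 / Real.pi ^ 2 * angle a b ^ 2 :=
    Real.cos_le_one_sub_mul_cos_sq
      (by rw [abs_of_nonneg (angle_nonneg a b)]; exact angle_le_pi a b)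
  have hlaw := norm_sub_sq_real a b
  rw [← cos_angle_mul_norm_mul_norm a b] at hlaw
  have hmul : m * m ≤ ‖a‖ * ‖b‖ := mul_le_mul ha hb hm.le (norm_nonneg a)
  have hle : 2 * (m * m) * (1 - Real.cos (angle a b)) ≤ ‖a - b‖ ^ 2 := by
    nlinarith [sq_nonneg (‖a‖ - ‖b‖),
      mul_le_mul_of_nonneg_right hmul (sub_nonneg.2 (Real.cos_le_one (angle a b)))]
  have hpi := Real.pi_pos
  have hsq : (2 * m / Real.pi * angle a b) ^ 2 ≤ ‖a - b‖ ^ 2 := by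
    calc (2 * m / Real.pi * angle a b) ^ 2
        = 2 * (m * m) * (2 / Real.pi ^ 2 * angle a b ^ 2) := by ring
      _ ≤ 2 * (m * m) * (1 - Real.cos (angle a b)) := by gcongr; linarith
      _ ≤ ‖a - b‖ ^ 2 := hle
  have h := le_of_sq_le_sq hsq (norm_nonneg _)
  calc angle a b = Real.pi / 2 * (2 * m / Real.pi * angle a b / m) := by field_simp
    _ ≤ Real.pi / 2 * (‖a - b‖ / m) := by gcongr

/-- As long as the budget `∑ B` is smaller than the norm of the initial vector, the drift of the
recursion is bounded by the partial sums of `B`. -/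
theorem norm_sub_zero_le_sum_of_RMSN_rec {d L : ℕ}
    {F : ℕ → EuclideanSpace ℝ (Fin d) → EuclideanSpace ℝ (Fin d)} {B : ℕ → ℝ}
    (hB : ∀ ℓ < L, 0 ≤ B ℓ)
    (hF : ∀ ℓ < L, ∀ u : EuclideanSpace ℝ (Fin d), ‖u‖ = Real.sqrt d → ‖F ℓ u‖ ≤ B ℓ)
    {y : ℕ → EuclideanSpace ℝ (Fin d)}
    (hrec : ∀ ℓ < L, y (ℓ + 1) = y ℓ + F ℓ (RMSN (y ℓ)))
    (hy : ∑ ℓ ∈ Finset.range L, B ℓ < ‖y 0‖) :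
    ∀ k ≤ L, ‖y 0 - y k‖ ≤ ∑ ℓ ∈ Finset.range k, B ℓ := by
  intro k
  induction k with
  | zero => simp
  | succ k ih =>
    intro hk
    have hdrift := ih (Nat.le_of_succ_le hk)
    have hsum : ∑ ℓ ∈ Finset.range k, B ℓ ≤ ∑ ℓ ∈ Finset.range L, B ℓ :=
      Finset.sum_le_sum_of_subset_of_nonneg
        (Finset.range_subset_range.2 (Nat.le_of_succ_le hk))
        fun ℓ hℓ _ => hB ℓ (Finset.mem_range.1 hℓ)
    have hne : y k ≠ 0 := by
      intro h0
      rw [h0, sub_zero] at hdrift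
      linarith
    rw [hrec k hk, Finset.sum_range_succ, ← sub_sub]
    exact (norm_sub_le _ _).trans (add_le_add hdrift (hF k hk _ (norm_RMSN hne)))

/-- Corollary 1 (scaling implies directional freezing): applying a stack of `L`
pre-norm blocks to the scaled initial token `α • x₀`, the total directional
drift is bounded by `(π/2) S_L / (α ‖x₀‖ - S_L)`, which tends to `0` as
`α → ∞`; hence the angle tends to `0`. -/
theorem scaling_directional_freezing
    (d : ℕ) (hd : 1 ≤ d) (L : ℕ)
    (F : ℕ → EuclideanSpace ℝ (Fin d) → EuclideanSpace ℝ (Fin d)) (B : ℕ → ℝ)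
    (hF : ∀ ℓ < L, ∀ u : EuclideanSpace ℝ (Fin d), ‖u‖ = Real.sqrt d →
      0 ≤ B ℓ ∧ ‖F ℓ u‖ ≤ B ℓ)
    (x₀ : EuclideanSpace ℝ (Fin d)) (hx₀ : x₀ ≠ 0)
    (x : ℝ → ℕ → EuclideanSpace ℝ (Fin d))
    (hinit : ∀ α : ℝ, x α 0 = α • x₀)
    (hrec : ∀ α : ℝ, ∀ ℓ < L, x α (ℓ + 1) = x α ℓ + F ℓ (RMSN (x α ℓ)))
    (SL : ℝ) (hSL : SL = ∑ ℓ ∈ Finset.range L, B ℓ) :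
    (∀ α : ℝ, SL < α * ‖x₀‖ →
      angle (α • x₀) (x α L) ≤ (Real.pi / 2) * (SL / (α * ‖x₀‖ - SL))) ∧
    Filter.Tendsto (fun α : ℝ => (Real.pi / 2) * (SL / (α * ‖x₀‖ - SL)))
      Filter.atTop (nhds 0) ∧
    Filter.Tendsto (fun α : ℝ => angle (α • x₀) (x α L)) Filter.atTop (nhds 0) := by
  have hB : ∀ ℓ < L, 0 ≤ B ℓ := fun ℓ hℓ => (hF ℓ hℓ _ (norm_RMSN hx₀)).1
  have hSL0 : 0 ≤ SL := hSL ▸ Finset.sum_nonneg fun ℓ hℓ => hB ℓ (Finset.mem_range.1 hℓ)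
  have hnorm : 0 < ‖x₀‖ := norm_pos_iff.2 hx₀
  have hbound : ∀ α : ℝ, SL < α * ‖x₀‖ →
      angle (α • x₀) (x α L) ≤ (Real.pi / 2) * (SL / (α * ‖x₀‖ - SL)) := by
    intro α hα
    have hαpos : 0 < α := pos_of_mul_pos_left (hSL0.trans_lt hα) hnorm.le
    have hy : ‖x α 0‖ = α * ‖x₀‖ := by rw [hinit, norm_smul, Real.norm_of_nonneg hαpos.le]
    have hdrift : ‖x α 0 - x α L‖ ≤ SL := by
      rw [hSL]
      exact norm_sub_zero_le_sum_of_RMSN_rec hB (fun ℓ hℓ u hu => (hF ℓ hℓ u hu).2) (hrec α)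
        (by rw [hy, ← hSL]; exact hα) L le_rfl
    have hm : 0 < α * ‖x₀‖ - SL := sub_pos.2 hα
    rw [← hinit α]
    refine (angle_le_pi_div_two_mul_norm_sub_div hm (by linarith) ?_).trans ?_
    · linarith [norm_sub_norm_le (x α 0) (x α L)]
    · have := Real.pi_pos
      gcongr
  have hmul : Filter.Tendsto (fun α : ℝ => α * ‖x₀‖) Filter.atTop Filter.atTop :=
    Filter.tendsto_id.atTop_mul_const hnorm
  have hlim : Filter.Tendsto (fun α : ℝ => (Real.pi / 2) * (SL / (α * ‖x₀‖ - SL)))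
      Filter.atTop (nhds 0) := by
    simpa [sub_eq_add_neg] using
      ((Filter.tendsto_atTop_add_const_right _ (-SL) hmul).const_div_atTop SL).const_mul
        (Real.pi / 2)
  refine ⟨hbound, hlim, squeeze_zero' (Filter.Eventually.of_forall fun α => angle_nonneg _ _) ?_
    hlim⟩
  filter_upwards [hmul.eventually_gt_atTop SL] with α hα using hbound α hα
end
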